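/- For every positive real number x, if x² = (√5 − 1)/2, then cos(arctan x) = x. -/

import Mathlib

theorem stmt_8 (x : ℝ) (hx : 0 < x)
    (h : x ^ 2 = (Real.sqrt 5 - 1) / 2) :
    Real.cos (Real.arctan x) = x := by
  have h5 : Real.sqrt 5 ^ 2 = 5 := Real.sq_sqrt (by norm_num)
  have hs : Real.cos (Real.arctan x) ^ 2 = x ^ 2 := by
    rw [Real.cos_sq_arctan, div_eq_iff (by positivity), h]
    nlinarith
  exact (pow_left_inj₀ (Real.cos_arctan_pos x).le hx.le (by norm_num)).mp hs
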